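/- The normed plane (ℝ², N) with N(x₁,x₂) = √(x₁² + 2x₂²) + |x₂| is strictly convex: whenever N(x) = N(y) = 1 and x ≠ y, one has N((x+y)/2) < 1. -/

import Mathlib

/-- The norm of the singular Minkowski plane. -/
noncomputable def singN (x : ℝ × ℝ) : ℝ :=
  Real.sqrt (x.1 ^ 2 + 2 * x.2 ^ 2) + |x.2|

theorem singN_eq_one {x : ℝ × ℝ} (h : singN x = 1) :
    x.1 ^ 2 + x.2 ^ 2 + 2 * |x.2| = 1 := by
  have hs : Real.sqrt (x.1 ^ 2 + 2 * x.2 ^ 2) = 1 - |x.2| := by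
    unfold singN at h
    linarith
  have hsq := Real.sq_sqrt (show 0 ≤ x.1 ^ 2 + 2 * x.2 ^ 2 by positivity)
  rw [hs] at hsq
  linarith [sq_abs x.2]

theorem singN_lt_one {x : ℝ × ℝ} (h : x.1 ^ 2 + x.2 ^ 2 + 2 * |x.2| < 1) :
    singN x < 1 := by
  have hb : |x.2| < 1 := by nlinarith [sq_nonneg x.1, sq_nonneg x.2]
  have hs : Real.sqrt (x.1 ^ 2 + 2 * x.2 ^ 2) < 1 - |x.2| := by
    rw [Real.sqrt_lt' (by linarith)]
    linarith [sq_abs x.2]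
  unfold singN
  linarith

/-- The singular Minkowski plane is strictly convex. -/
theorem singN_strictly_convex :
    ∀ x y : ℝ × ℝ, singN x = 1 → singN y = 1 → x ≠ y →
      singN ((2 : ℝ)⁻¹ • (x + y)) < 1 := by
  rintro ⟨a, b⟩ ⟨c, d⟩ hx hy hne
  have h₁ := singN_eq_one hx
  have h₂ := singN_eq_one hy
  apply singN_lt_one
  simp only [Prod.smul_fst, Prod.smul_snd, Prod.fst_add, Prod.snd_add, smul_eq_mul,
    abs_mul] at h₁ h₂ ⊢
  rw [abs_of_pos (by norm_num : (0 : ℝ) < 2⁻¹)]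
  have habs := abs_add_le b d
  have hpos : 0 < (a - c) ^ 2 + (b - d) ^ 2 := by
    by_cases hac : a = c
    · have hbd : b - d ≠ 0 := fun h => hne (Prod.ext hac (sub_eq_zero.mp h))
      positivity
    · have hac' : a - c ≠ 0 := sub_ne_zero.mpr hac
      positivity
  nlinarith
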